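/- Under the λ-setup and the semi-discrete assumptions with discrete inf-sup constant β* > 0 on Q_h (sup_{v ∈ V_h} b(v,q)/‖v‖_V ≥ β*‖q‖_Q for all q ∈ Q_h), let Λ > 0, let λ ∈ (0,Λ], let (u,p) solve Problem (P_λ) and let (u_h,p_h) ∈ L¹(J;V_h) × L¹(J;Q_h) be the unique solution of the semi-discrete Problem (P_{λ,h}). Then there exists a constant C > 0, depending only on α₀*, β*, ‖a‖, ‖b‖, C_{k₁}, C_{k₂}, T and Λ — in particular independent of λ and of the subspaces V_h, Q_h — such that ‖u_h − u‖_{L¹(J;V)} + ‖p_h − p‖_{L¹(J;Q)} ≤ C ( inf_{v ∈ L¹(J;V_h)} ‖u − v‖_{L¹(J;V)} + inf_{q ∈ L¹(J;Q_h)} ‖p − q‖_{L¹(J;Q)} ). -/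

import Mathlib

open MeasureTheory
open scoped RealInnerProductSpace

/-- `(u, p)` solves the parameter-dependent Problem (P_λ) tested against `Vt × Qt`
(for `Vt = ⊤`, `Qt = ⊤` this is Problem (P_λ); for subspaces the semi-discrete
Problem (P_{λ,h})). -/
def SolvesPlamOn (V Q : Type) [NormedAddCommGroup V] [NormedSpace ℝ V]
    [NormedAddCommGroup Q] [InnerProductSpace ℝ Q] (T lam : ℝ)
    (a : V →L[ℝ] V →L[ℝ] ℝ) (b : V →L[ℝ] Q →L[ℝ] ℝ)
    (k₁ k₂ : ℝ → ℝ → ℝ) (f : ℝ → V →L[ℝ] ℝ) (g : ℝ → Q →L[ℝ] ℝ)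
    (Vt : Submodule ℝ V) (Qt : Submodule ℝ Q)
    (u : ℝ → V) (p : ℝ → Q) : Prop :=
  ∀ᵐ t ∂volume, t ∈ Set.Icc (0:ℝ) T →
    (∀ v ∈ Vt, a (u t) v + b v (p t)
        = f t v + ∫ s in (0:ℝ)..t, (k₁ t s * a (u s) v + k₂ t s * b v (p s))) ∧
    (∀ q ∈ Qt, b (u t) q - lam * ⟪p t, q⟫ = g t q)

/-- The discrete kernel `K_h = {v ∈ V_h : b(v,q) = 0 ∀ q ∈ Q_h}`. -/
noncomputable def discKh (V Q : Type) [NormedAddCommGroup V] [NormedSpace ℝ V]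
    [NormedAddCommGroup Q] [NormedSpace ℝ Q] (b : V →L[ℝ] Q →L[ℝ] ℝ)
    (Vh : Submodule ℝ V) (Qh : Submodule ℝ Q) : Submodule ℝ V :=
  Vh ⊓ ⨅ q ∈ Qh, LinearMap.ker (b.flip q : V →ₗ[ℝ] ℝ)


lemma aux_cs {V : Type} [NormedAddCommGroup V] [InnerProductSpace ℝ V]
    (a : V →L[ℝ] V →L[ℝ] ℝ) (hs : ∀ v w : V, a v w = a w v) (hp : ∀ v : V, 0 ≤ a v v)
    (x y : V) : |a x y| ≤ √(a x x) * √(a y y) := by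
  rw [← Real.sqrt_mul (hp x)]
  apply Real.abs_le_sqrt
  have h : ∀ t : ℝ, 0 ≤ a y y * (t * t) + (2 * a x y) * t + a x x := by
    intro t
    have := hp (x + t • y)
    simp only [map_add, map_smul, add_apply,
      smul_apply, smul_eq_mul, hs y x] at this
    linarith
  have := discrim_le_zero h
  unfold discrim at this
  nlinarith

lemma aux_lift {V Q : Type} [NormedAddCommGroup V] [InnerProductSpace ℝ V]
    [NormedAddCommGroup Q] [InnerProductSpace ℝ Q]
    (b : V →L[ℝ] Q →L[ℝ] ℝ) (Vh : Submodule ℝ V) (Qh : Submodule ℝ Q)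
    [FiniteDimensional ℝ Vh] [FiniteDimensional ℝ Qh] (β : ℝ) (hβ : 0 < β)
    (his : ∀ q ∈ Qh, ∃ v ∈ Vh, ‖v‖ ≤ 1 ∧ β * ‖q‖ ≤ b v q)
    (e : V) (he : e ∈ Vh) (M : ℝ) (hM : 0 ≤ M) (hbe : ∀ z ∈ Qh, b e z ≤ M * ‖z‖) :
    ∃ e1 ∈ Vh, (∀ z ∈ Qh, b e1 z = b e z) ∧ β * ‖e1‖ ≤ M := by
  let B : Vh →ₗ[ℝ] Qh :=
    { toFun := fun v => (InnerProductSpace.toDual ℝ Qh).symm ((b v).comp Qh.subtypeL)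
      map_add' := by
        intro x y
        rw [← map_add]; congr 1; ext z; simp
      map_smul' := by
        intro c x
        apply ext_inner_right ℝ
        intro z
        simp [inner_smul_left] }
  have hB : ∀ (v : Vh) (z : Qh), ⟪B v, z⟫ = b v z := by
    intro v z
    simp [B]
  have hBt : ∀ (z : Qh) (v : Vh), ⟪LinearMap.adjoint B z, v⟫ = b v z := by
    intro z v
    rw [LinearMap.adjoint_inner_left, real_inner_comm, hB]
  have hlow : ∀ z : Qh, β * ‖z‖ ≤ ‖LinearMap.adjoint B z‖ := by
    intro z
    obtain ⟨v, hv, hv1, hvz⟩ := his z z.2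
    have h1 := hBt z ⟨v, hv⟩
    have h2 := real_inner_le_norm (LinearMap.adjoint B z) (⟨v, hv⟩ : Vh)
    have h3 : ‖(⟨v, hv⟩ : Vh)‖ ≤ 1 := hv1
    have h4 : β * ‖z‖ ≤ b v z := hvz
    rw [h1] at h2
    have h5 := mul_le_of_le_one_right (norm_nonneg (LinearMap.adjoint B z)) h3
    simp only at h2
    linarith
  have hinner : ∀ z : Qh, ⟪B (LinearMap.adjoint B z), z⟫ = ‖LinearMap.adjoint B z‖ ^ 2 := by
    intro z
    rw [← LinearMap.adjoint_inner_right, real_inner_self_eq_norm_sq]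
  have hinj : Function.Injective (B ∘ₗ LinearMap.adjoint B) := by
    rw [← LinearMap.ker_eq_bot, LinearMap.ker_eq_bot']
    intro z hz
    have h1 := hinner z
    rw [LinearMap.comp_apply] at hz
    rw [hz, inner_zero_left] at h1
    have h2 : ‖LinearMap.adjoint B z‖ = 0 := by
      exact pow_eq_zero_iff (two_ne_zero) |>.1 h1.symm
    have h3 := hlow z
    rw [h2] at h3
    have : ‖z‖ ≤ 0 := by
      by_contra hc
      push Not at hc
      have := mul_pos hβ hc
      linarith
    exact norm_le_zero_iff.1 this
  obtain ⟨z, hz⟩ := (LinearMap.injective_iff_surjective.1 hinj) (B ⟨e, he⟩)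
  rw [LinearMap.comp_apply] at hz
  refine ⟨LinearMap.adjoint B z, (LinearMap.adjoint B z).2, ?_, ?_⟩
  · intro w hw
    rw [← hB _ ⟨w, hw⟩, hz, hB]
  · have h1 := hinner z
    rw [hz, hB] at h1
    have h2 := hbe z z.2
    have h3 := hlow z
    have h4 : ‖((LinearMap.adjoint B z : Vh) : V)‖ = ‖LinearMap.adjoint B z‖ := rfl
    rw [h4]
    have h5 : ‖((z : Qh) : Q)‖ = ‖z‖ := rfl
    rw [h5] at h2
    simp only at h1
    set x := ‖LinearMap.adjoint B z‖
    have hx : 0 ≤ x := norm_nonneg _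
    rcases hx.eq_or_lt with h | h
    · rw [← h]; simpa using hM
    · have : x * (β * x) ≤ x * M := by nlinarith
      exact le_of_mul_le_mul_left this h

lemma aux_alg (n β m L : ℝ) (hn : 0 < n) (hβ : 0 < β) (hm : 0 ≤ m) (hL : 0 ≤ L) :
    ∃ C : ℝ, 0 < C ∧ ∀ x y s k F G lam : ℝ, 0 ≤ x → 0 ≤ y → 0 ≤ s → 0 ≤ k → 0 ≤ F → 0 ≤ G →
      0 ≤ lam → lam ≤ L → β * y ≤ F + m * s → β * k ≤ lam * y + G → n * (x - k) ≤ s + m * k →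
      s ^ 2 ≤ F * x + G * y → x + y ≤ C * (F + G) := by
  set c1 := (1 + m) / β with hc1
  set c2 := (L * c1 + 1) / β with hc2
  set c3 := (1 + m * c2) / n + c2 with hc3
  have p1 : 0 < c1 := by positivity
  have p2 : 0 < c2 := by positivity
  have p3 : 0 < c3 := by positivity
  refine ⟨(c1 + c3) * (c1 + c3 + 2), by positivity, ?_⟩
  intro x y s k F G lam hx hy hs hk hF hG hl hlL h1 h2 h3 h4
  have e1 : y ≤ c1 * (F + G + s) := by
    rw [hc1, div_mul_eq_mul_div, le_div_iff₀ hβ]; nlinarith [mul_nonneg hm hF, mul_nonneg hm hG]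
  have e2 : k ≤ c2 * (F + G + s) := by
    rw [hc2, div_mul_eq_mul_div, le_div_iff₀ hβ]
    nlinarith [mul_le_mul_of_nonneg_right hlL hy, mul_le_mul_of_nonneg_left e1 hL]
  have e3 : x - k ≤ (1 + m * c2) / n * (F + G + s) := by
    rw [div_mul_eq_mul_div, le_div_iff₀ hn]
    nlinarith [mul_le_mul_of_nonneg_left e2 hm]
  have e4 : x + y ≤ (c1 + c3) * (F + G + s) := by
    rw [hc3]; nlinarith
  set c := c1 + c3
  have hc : 0 < c := by positivity
  have hS : 0 ≤ F + G := by positivity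
  set S := F + G with hSd
  have e5 : s ^ 2 ≤ S * (x + y) := by nlinarith [mul_nonneg hF hy, mul_nonneg hG hx]
  have e6 : s ^ 2 ≤ S * (c * (S + s)) := e5.trans (mul_le_mul_of_nonneg_left e4 hS)
  have e7 : s ≤ (c + 1) * S := by
    by_contra hcon
    push Not at hcon
    have hs0 : 0 < s := lt_of_le_of_lt (by positivity) hcon
    have : (c + 1) * S * s < s * s := mul_lt_mul_of_pos_right hcon hs0
    have : S * ((c + 1) * S) ≤ S * s := mul_le_mul_of_nonneg_left hcon.le hS
    nlinarith [mul_nonneg hS hS]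
  calc x + y ≤ c * (S + s) := e4
    _ ≤ c * (S + (c + 1) * S) := by gcongr
    _ = _ := by ring

lemma aux_stab (α β Na L : ℝ) (hα : 0 < α) (hβ : 0 < β) (hNa : 0 ≤ Na) (hL : 0 ≤ L) :
    ∃ C : ℝ, 0 < C ∧ ∀ (V Q : Type) [NormedAddCommGroup V] [InnerProductSpace ℝ V]
    [NormedAddCommGroup Q] [InnerProductSpace ℝ Q]
    (a : V →L[ℝ] V →L[ℝ] ℝ) (b : V →L[ℝ] Q →L[ℝ] ℝ),
    (∀ v w : V, a v w = a w v) → (∀ v : V, 0 ≤ a v v) → ‖a‖ ≤ Na →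
    ∀ (Vh : Submodule ℝ V) (Qh : Submodule ℝ Q),
    FiniteDimensional ℝ Vh → FiniteDimensional ℝ Qh →
    (∀ v ∈ Vh, (∀ q ∈ Qh, b v q = 0) → α * ‖v‖ ^ 2 ≤ a v v) →
    (∀ q ∈ Qh, ∃ v ∈ Vh, ‖v‖ ≤ 1 ∧ β * ‖q‖ ≤ b v q) →
    ∀ lam : ℝ, 0 < lam → lam ≤ L → ∀ F G : ℝ, 0 ≤ F → 0 ≤ G →
    ∀ e ∈ Vh, ∀ r ∈ Qh, (∀ w ∈ Vh, |a e w + b w r| ≤ F * ‖w‖) →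
    (∀ z ∈ Qh, |b e z - lam * ⟪r, z⟫| ≤ G * ‖z‖) → ‖e‖ + ‖r‖ ≤ C * (F + G) := by
  obtain ⟨C, hC, H⟩ := aux_alg (√α) β (√Na) L (Real.sqrt_pos.2 hα) hβ (Real.sqrt_nonneg _) hL
  refine ⟨C, hC, ?_⟩
  intro V Q _ _ _ _ a b hs hp ha Vh Qh _ _ hell his lam hl hlL F G hF hG e he r hr h1 h2
  have hbd : ∀ w : V, √(a w w) ≤ √Na * ‖w‖ := by
    intro w
    rw [← Real.sqrt_sq (norm_nonneg w), ← Real.sqrt_mul hNa]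
    apply Real.sqrt_le_sqrt
    have := a.le_opNorm₂ w w
    have h3 := (le_abs_self _).trans this
    have : ‖a‖ * ‖w‖ * ‖w‖ ≤ Na * ‖w‖ ^ 2 := by
      rw [mul_assoc, ← sq]; gcongr
    linarith
  have hbe : ∀ z ∈ Qh, b e z ≤ (lam * ‖r‖ + G) * ‖z‖ := by
    intro z hz
    have := (le_abs_self _).trans (h2 z hz)
    have h3 := mul_le_mul_of_nonneg_left (real_inner_le_norm r z) hl.le
    nlinarith
  obtain ⟨e1, he1, hz1, hn1⟩ := aux_lift b Vh Qh β hβ his e he (lam * ‖r‖ + G)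
    (by positivity) hbe
  have hcs := aux_cs a hs hp
  refine H ‖e‖ ‖r‖ (√(a e e)) ‖e1‖ F G lam (norm_nonneg _) (norm_nonneg _) (Real.sqrt_nonneg _)
    (norm_nonneg _) hF hG hl.le hlL ?_ hn1 ?_ ?_
  · obtain ⟨w, hw, hw1, hwr⟩ := his r hr
    have h3 := (le_abs_self _).trans (h1 w hw)
    have h4 := (neg_le_abs _).trans (hcs e w)
    have h5 : √(a e e) * √(a w w) ≤ √Na * √(a e e) := by
      rw [mul_comm]
      exact mul_le_mul_of_nonneg_right
        ((hbd w).trans (mul_le_of_le_one_right (Real.sqrt_nonneg _) hw1)) (Real.sqrt_nonneg _)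
    have h6 := mul_le_of_le_one_right hF hw1
    linarith
  · have h3 := hell (e - e1) (Vh.sub_mem he he1) (by
      intro q hq
      simp [hz1 q hq])
    have h4 : a (e - e1) (e - e1) ≤ (√(a e e) + √Na * ‖e1‖) ^ 2 := by
      have h5 := (neg_le_abs _).trans (hcs e e1)
      have h6 := Real.sq_sqrt (hp e)
      have h7 := Real.sq_sqrt (hp e1)
      have : a (e - e1) (e - e1) ≤ (√(a e e) + √(a e1 e1)) ^ 2 := by
        simp only [map_sub, sub_apply, hs e1 e]
        nlinarith
      refine this.trans ?_
      gcongr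
      exact hbd e1
    have h5 : √α * ‖e - e1‖ ≤ √(a e e) + √Na * ‖e1‖ := by
      apply le_of_sq_le_sq _ (by positivity)
      rw [mul_pow, Real.sq_sqrt hα.le]
      linarith
    refine le_trans ?_ h5
    gcongr
    exact norm_sub_norm_le _ _
  · rw [Real.sq_sqrt (hp e)]
    have h3 := (le_abs_self _).trans (h1 e he)
    have h4 := (neg_le_abs _).trans (h2 r hr)
    have h5 : 0 ≤ lam * ⟪r, r⟫ := mul_nonneg hl.le real_inner_self_nonneg
    linarith

lemma aux_gron (T c1 c2 : ℝ) (hT : 0 < T) (hc1 : 0 ≤ c1) (hc2 : 0 ≤ c2) (φ ψ : ℝ → ℝ)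
    (hφ : IntervalIntegrable φ volume 0 T) (hψ : IntervalIntegrable ψ volume 0 T)
    (hφ0 : ∀ t, 0 ≤ φ t) (hψ0 : ∀ t, 0 ≤ ψ t)
    (h : ∀ᵐ t ∂volume, t ∈ Set.Icc (0:ℝ) T → φ t ≤ c1 * ψ t + c2 * ∫ s in (0:ℝ)..t, φ s) :
    ∫ t in (0:ℝ)..T, φ t ≤ c1 * Real.exp (c2 * T) * ∫ t in (0:ℝ)..T, ψ t := by
  set φ' : ℝ → ℝ := Set.indicator (Set.Ioc 0 T) φ with hφ'
  have hφ'i : Integrable φ' volume := by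
    rw [hφ', integrable_indicator_iff measurableSet_Ioc]
    exact hφ.1
  have hφ'0 : ∀ t, 0 ≤ φ' t := fun t => Set.indicator_nonneg (fun t _ => hφ0 t) t
  set Φ : ℝ → ℝ := fun t => ∫ s in (0:ℝ)..t, φ' s with hΦ
  have hΦc : Continuous Φ :=
    intervalIntegral.continuous_primitive (fun a b => hφ'i.intervalIntegrable) 0
  have hΦeq : ∀ t ∈ Set.Icc 0 T, Φ t = ∫ s in (0:ℝ)..t, φ s := by
    intro t ht
    apply intervalIntegral.integral_congr_ae
    refine Filter.Eventually.of_forall fun s hs => ?_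
    rw [Set.uIoc_of_le ht.1] at hs
    have hs' : s ∈ Set.Ioc 0 T := ⟨hs.1, hs.2.trans ht.2⟩
    exact Set.indicator_of_mem hs' _
  have hΦ0 : ∀ t ∈ Set.Icc 0 T, 0 ≤ Φ t := fun t ht =>
    intervalIntegral.integral_nonneg ht.1 (fun s _ => hφ'0 s)
  have hΨ0 : 0 ≤ ∫ t in (0:ℝ)..T, ψ t := intervalIntegral.integral_nonneg hT.le (fun s _ => hψ0 s)
  set A := c1 * ∫ t in (0:ℝ)..T, ψ t with hA
  have hA0 : 0 ≤ A := mul_nonneg hc1 hΨ0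
  set H : ℝ → ℝ := fun t => A + c2 * ∫ s in (0:ℝ)..t, Φ s with hH
  have hHd : ∀ t, HasDerivAt H (c2 * Φ t) t := by
    intro t
    exact ((hΦc.integral_hasStrictDerivAt 0 t).hasDerivAt.const_mul c2).const_add A
  have hle : ∀ t ∈ Set.Icc 0 T, Φ t ≤ H t := by
    intro t ht
    have hsub : Set.uIcc 0 t ⊆ Set.uIcc 0 T := by
      rw [Set.uIcc_of_le ht.1, Set.uIcc_of_le hT.le]
      exact Set.Icc_subset_Icc_right ht.2
    have i1 : IntervalIntegrable φ volume 0 t := hφ.mono_set hsub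
    have i2 : IntervalIntegrable ψ volume 0 t := hψ.mono_set hsub
    have i3 : IntervalIntegrable Φ volume 0 t := hΦc.intervalIntegrable _ _
    rw [hΦeq t ht]
    have h1 : ∫ s in (0:ℝ)..t, φ s ≤ ∫ s in (0:ℝ)..t, (c1 * ψ s + c2 * Φ s) := by
      apply intervalIntegral.integral_mono_ae_restrict ht.1 i1
        ((i2.const_mul c1).add (i3.const_mul c2))
      rw [Filter.EventuallyLE, ae_restrict_iff' measurableSet_Icc]
      filter_upwards [h] with s hs hst
      have hsT : s ∈ Set.Icc 0 T := ⟨hst.1, hst.2.trans ht.2⟩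
      rw [hΦeq s hsT]
      exact hs hsT
    rw [intervalIntegral.integral_add (i2.const_mul c1) (i3.const_mul c2),
      intervalIntegral.integral_const_mul, intervalIntegral.integral_const_mul] at h1
    have h2 : ∫ s in (0:ℝ)..t, ψ s ≤ ∫ s in (0:ℝ)..T, ψ s :=
      intervalIntegral.integral_mono_interval le_rfl ht.1 ht.2
        (Filter.Eventually.of_forall hψ0) hψ
    have h3 := mul_le_mul_of_nonneg_left h2 hc1
    simp only [hH, hA]
    linarith
  have hT' : T ∈ Set.Icc 0 T := ⟨hT.le, le_rfl⟩
  have key := norm_le_gronwallBound_of_norm_deriv_right_le (f := H) (f' := fun t => c2 * Φ t)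
    (δ := A) (K := c2) (ε := 0) (a := 0) (b := T)
    (fun t _ => (hHd t).continuousAt.continuousWithinAt)
    (fun t _ => (hHd t).hasDerivWithinAt)
    (by simp [hH, abs_of_nonneg hA0])
    (by
      intro t ht
      have ht' : t ∈ Set.Icc 0 T := Set.Ico_subset_Icc_self ht
      rw [add_zero, norm_mul, Real.norm_of_nonneg hc2]
      refine mul_le_mul_of_nonneg_left ?_ hc2
      rw [Real.norm_of_nonneg (hΦ0 t ht')]
      exact (hle t ht').trans (le_abs_self _)) T hT'
  rw [gronwallBound_ε0, sub_zero] at key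
  have h1 := hle T hT'
  rw [hΦeq T hT'] at h1
  have h2 := (le_abs_self _).trans key
  calc _ ≤ _ := h1.trans h2
    _ = _ := by rw [hA]; ring

lemma aux_ii (t Ck : ℝ) (ht : 0 ≤ t) (κ x : ℝ → ℝ) (hκ : Measurable κ)
    (hb : ∀ᵐ s ∂volume, s ∈ Set.Ioc 0 t → |κ s| ≤ Ck) (hx : IntervalIntegrable x volume 0 t) :
    IntervalIntegrable (fun s => κ s * x s) volume 0 t := by
  refine (hx.norm.const_mul Ck).mono_fun' (hκ.aestronglyMeasurable.mul hx.aestronglyMeasurable_restrict_uIoc) ?_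
  rw [Set.uIoc_of_le ht, Filter.EventuallyLE, ae_restrict_iff' measurableSet_Ioc]
  filter_upwards [hb] with s hs hst
  rw [norm_mul]
  exact mul_le_mul_of_nonneg_right (hs hst) (norm_nonneg _)

/-- Under the λ-setup and the semi-discrete assumptions with
discrete inf-sup constant `β* > 0` on `Q_h`, there exists `C > 0` depending only on
`α₀*, β*, ‖a‖, ‖b‖, C_{k₁}, C_{k₂}, T, Λ` — in particular independent of
`λ ∈ (0,Λ]` and of the subspaces `V_h, Q_h` — such that if `(u,p)` solves Problem
(P_λ) and `(u_h,p_h)` is the unique solution of Problem (P_{λ,h}), then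
`‖u_h − u‖₁ + ‖p_h − p‖₁ ≤ C (inf_{v ∈ L¹(J;V_h)} ‖u − v‖₁ + inf_{q ∈ L¹(J;Q_h)} ‖p − q‖₁)`. -/
theorem statement15
    (α₀s βs Na Nb Ck1 Ck2 T Lam : ℝ)
    (hα₀s : 0 < α₀s) (hβs : 0 < βs) (hT : 0 < T) (hLam : 0 < Lam)
    (hNa : 0 ≤ Na) (hNb : 0 ≤ Nb) (hCk1 : 0 ≤ Ck1) (hCk2 : 0 ≤ Ck2) :
    ∃ C : ℝ, 0 < C ∧
      ∀ (V Q : Type)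
        [NormedAddCommGroup V] [InnerProductSpace ℝ V] [CompleteSpace V]
        [NormedAddCommGroup Q] [InnerProductSpace ℝ Q] [CompleteSpace Q]
        (a : V →L[ℝ] V →L[ℝ] ℝ) (b : V →L[ℝ] Q →L[ℝ] ℝ)
        (k₁ k₂ : ℝ → ℝ → ℝ),
        (∀ v w : V, a v w = a w v) → (∀ v : V, 0 ≤ a v v) →
        ‖a‖ ≤ Na → ‖b‖ ≤ Nb →
        Measurable (Function.uncurry k₁) → Measurable (Function.uncurry k₂) →
        (∀ᵐ ts : ℝ × ℝ ∂volume,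
          0 ≤ ts.2 → ts.2 ≤ ts.1 → ts.1 ≤ T → |k₁ ts.1 ts.2| ≤ Ck1) →
        (∀ᵐ ts : ℝ × ℝ ∂volume,
          0 ≤ ts.2 → ts.2 ≤ ts.1 → ts.1 ≤ T → |k₂ ts.1 ts.2| ≤ Ck2) →
        ∀ (Vh : Submodule ℝ V) (Qh : Submodule ℝ Q),
        FiniteDimensional ℝ Vh → FiniteDimensional ℝ Qh →
        -- ellipticity on the discrete kernel
        (∀ v ∈ discKh V Q b Vh Qh, α₀s * ‖v‖ ^ 2 ≤ a v v) →
        -- discrete inf-sup condition on Q_h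
        (∀ q ∈ Qh, ∃ v ∈ Vh, ‖v‖ ≤ 1 ∧ βs * ‖q‖ ≤ b v q) →
        ∀ lam : ℝ, 0 < lam → lam ≤ Lam →
        ∀ (f : ℝ → V →L[ℝ] ℝ) (g : ℝ → Q →L[ℝ] ℝ),
        IntervalIntegrable f volume 0 T → IntervalIntegrable g volume 0 T →
        ∀ (u : ℝ → V) (p : ℝ → Q),
          IntervalIntegrable u volume 0 T → IntervalIntegrable p volume 0 T →
          SolvesPlamOn V Q T lam a b k₁ k₂ f g ⊤ ⊤ u p →
        ∀ (uh : ℝ → V) (ph : ℝ → Q),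
          (∀ t : ℝ, uh t ∈ Vh) → (∀ t : ℝ, ph t ∈ Qh) →
          IntervalIntegrable uh volume 0 T → IntervalIntegrable ph volume 0 T →
          SolvesPlamOn V Q T lam a b k₁ k₂ f g Vh Qh uh ph →
        ∀ (v : ℝ → V) (q : ℝ → Q),
          (∀ t : ℝ, v t ∈ Vh) → (∀ t : ℝ, q t ∈ Qh) →
          IntervalIntegrable v volume 0 T → IntervalIntegrable q volume 0 T →
          (∫ t in (0:ℝ)..T, ‖uh t - u t‖) + (∫ t in (0:ℝ)..T, ‖ph t - p t‖)
            ≤ C * ((∫ t in (0:ℝ)..T, ‖u t - v t‖)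
                + ∫ t in (0:ℝ)..T, ‖p t - q t‖) := by
  obtain ⟨C, hC, H⟩ := aux_stab α₀s βs Na Lam hα₀s hβs hNa hLam.le
  set K := Ck1 * Na + Ck2 * Nb with hK
  have hK0 : 0 ≤ K := by positivity
  refine ⟨(1 + C * (Na + Nb + Lam)) * Real.exp (C * K * T), by positivity, ?_⟩
  intro V Q _ _ _ _ _ _ a b k₁ k₂ hs hp ha hb hm1 hm2 hk1 hk2 Vh Qh hVh hQh hell his lam hl hlL
    f g _ _ u p hu hpi hsol uh ph huh hph huhi hphi hsolh v q hv hq hvi hqi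
  rw [← intervalIntegral.integral_add (huhi.sub hu).norm (hphi.sub hpi).norm,
    ← intervalIntegral.integral_add (hu.sub hvi).norm (hpi.sub hqi).norm]
  refine aux_gron T (1 + C * (Na + Nb + Lam)) (C * K) hT (by positivity) (by positivity) _ _
    ((huhi.sub hu).norm.add (hphi.sub hpi).norm) ((hu.sub hvi).norm.add (hpi.sub hqi).norm)
    (fun t => by positivity) (fun t => by positivity) ?_
  have hk1' := Measure.ae_ae_of_ae_prod (μ := (volume : Measure ℝ)) (ν := (volume : Measure ℝ)) hk1
  have hk2' := Measure.ae_ae_of_ae_prod (μ := (volume : Measure ℝ)) (ν := (volume : Measure ℝ)) hk2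
  have hA : ∀ x y : V, |a x y| ≤ Na * ‖x‖ * ‖y‖ := by
    intro x y
    have h1 := a.le_opNorm₂ x y
    rw [Real.norm_eq_abs] at h1
    exact h1.trans (by gcongr)
  have hBb : ∀ (x : V) (y : Q), |b x y| ≤ Nb * ‖x‖ * ‖y‖ := by
    intro x y
    have h1 := b.le_opNorm₂ x y
    rw [Real.norm_eq_abs] at h1
    exact h1.trans (by gcongr)
  unfold SolvesPlamOn at hsol hsolh
  filter_upwards [hsol, hsolh, hk1', hk2'] with t h1 h2 h3 h4 ht
  obtain ⟨h1a, h1b⟩ := h1 ht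
  obtain ⟨h2a, h2b⟩ := h2 ht
  have b1 : ∀ᵐ s ∂volume, s ∈ Set.Ioc 0 t → |k₁ t s| ≤ Ck1 := by
    filter_upwards [h3] with s hs hst using hs hst.1.le hst.2 ht.2
  have b2 : ∀ᵐ s ∂volume, s ∈ Set.Ioc 0 t → |k₂ t s| ≤ Ck2 := by
    filter_upwards [h4] with s hs hst using hs hst.1.le hst.2 ht.2
  have hsub : Set.uIcc 0 t ⊆ Set.uIcc 0 T := by
    rw [Set.uIcc_of_le ht.1, Set.uIcc_of_le hT.le]
    exact Set.Icc_subset_Icc_right ht.2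
  have m1 : Measurable (k₁ t) := hm1.comp measurable_prodMk_left
  have m2 : Measurable (k₂ t) := hm2.comp measurable_prodMk_left
  have ia : ∀ (x : ℝ → V) (w : V), IntervalIntegrable x volume 0 T →
      IntervalIntegrable (fun s => k₁ t s * a (x s) w) volume 0 t := by
    intro x w hx
    refine aux_ii t Ck1 ht.1 _ _ m1 b1 ?_
    have hx' := hx.mono_set hsub
    exact ⟨(a.flip w).integrable_comp hx'.1, (a.flip w).integrable_comp hx'.2⟩
  have ib : ∀ (x : ℝ → Q) (w : V), IntervalIntegrable x volume 0 T →
      IntervalIntegrable (fun s => k₂ t s * b w (x s)) volume 0 t := by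
    intro x w hx
    refine aux_ii t Ck2 ht.1 _ _ m2 b2 ?_
    have hx' := hx.mono_set hsub
    exact ⟨(b w).integrable_comp hx'.1, (b w).integrable_comp hx'.2⟩
  set Φ := ∫ s in (0:ℝ)..t, (‖uh s - u s‖ + ‖ph s - p s‖) with hΦ
  have hΦ0 : 0 ≤ Φ := intervalIntegral.integral_nonneg ht.1 (fun s _ => by positivity)
  have hφi : IntervalIntegrable (fun s => ‖uh s - u s‖ + ‖ph s - p s‖) volume 0 t :=
    ((huhi.sub hu).norm.add (hphi.sub hpi).norm).mono_set hsub
  have hI : ∀ w ∈ Vh, |(a (uh t) w + b w (ph t)) - (a (u t) w + b w (p t))| ≤ K * Φ * ‖w‖ := by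
    intro w hw
    rw [h1a w trivial, h2a w hw, add_sub_add_left_eq_sub,
      ← intervalIntegral.integral_sub ((ia uh w huhi).add (ib ph w hphi))
        ((ia u w hu).add (ib p w hpi)), ← Real.norm_eq_abs]
    have hr : K * Φ * ‖w‖ =
        ∫ s in (0:ℝ)..t, (K * ‖w‖) * (‖uh s - u s‖ + ‖ph s - p s‖) := by
      rw [intervalIntegral.integral_const_mul]; ring
    rw [hr]
    refine intervalIntegral.norm_integral_le_of_norm_le ht.1 ?_ (hφi.const_mul _)
    filter_upwards [b1, b2] with s hs1 hs2 hst
    have e1 : k₁ t s * a (uh s) w + k₂ t s * b w (ph s) - (k₁ t s * a (u s) w + k₂ t s * b w (p s))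
        = k₁ t s * a (uh s - u s) w + k₂ t s * b w (ph s - p s) := by
      simp only [map_sub, sub_apply]; ring
    rw [e1, Real.norm_eq_abs]
    have e2 : |k₁ t s * a (uh s - u s) w| ≤ Ck1 * (Na * ‖uh s - u s‖ * ‖w‖) := by
      rw [abs_mul]; exact mul_le_mul (hs1 hst) (hA _ _) (abs_nonneg _) hCk1
    have e3 : |k₂ t s * b w (ph s - p s)| ≤ Ck2 * (Nb * ‖w‖ * ‖ph s - p s‖) := by
      rw [abs_mul]; exact mul_le_mul (hs2 hst) (hBb _ _) (abs_nonneg _) hCk2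
    refine (abs_add_le _ _).trans ((add_le_add e2 e3).trans ?_)
    have e4 : 0 ≤ Ck1 * Na * ‖w‖ * ‖ph s - p s‖ := by positivity
    have e5 : 0 ≤ Ck2 * Nb * ‖w‖ * ‖uh s - u s‖ := by positivity
    rw [hK]
    linarith
  have hst := H V Q a b hs hp ha Vh Qh hVh hQh
    (fun w hw hwq => hell w (by
      simp only [discKh, Submodule.mem_inf, Submodule.mem_iInf, LinearMap.mem_ker]
      exact ⟨hw, fun z hz => hwq z hz⟩)) his lam hl hlL
    (Na * ‖u t - v t‖ + Nb * ‖p t - q t‖ + K * Φ) (Nb * ‖u t - v t‖ + Lam * ‖p t - q t‖)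
    (by positivity) (by positivity) (uh t - v t) (Vh.sub_mem (huh t) (hv t))
    (ph t - q t) (Qh.sub_mem (hph t) (hq t))
    (by
      intro w hw
      have e1 : a (uh t - v t) w + b w (ph t - q t) = a (u t - v t) w + b w (p t - q t) +
          ((a (uh t) w + b w (ph t)) - (a (u t) w + b w (p t))) := by
        simp only [map_sub, sub_apply]; ring
      rw [e1]
      have e2 := hA (u t - v t) w
      have e3 := hBb w (p t - q t)
      have e4 := hI w hw
      refine (abs_add_le _ _).trans ?_
      have e5 := abs_add_le (a (u t - v t) w) (b w (p t - q t))
      linarith)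
    (by
      intro z hz
      have e1 : b (uh t - v t) z - lam * ⟪ph t - q t, z⟫
          = b (u t - v t) z - lam * ⟪p t - q t, z⟫ := by
        have e2 := h1b z trivial
        have e3 := h2b z hz
        simp only [map_sub, sub_apply, inner_sub_left]
        linarith
      rw [e1]
      have e2 := hBb (u t - v t) z
      have e3 : |lam * ⟪p t - q t, z⟫| ≤ Lam * (‖p t - q t‖ * ‖z‖) := by
        rw [abs_mul, abs_of_pos hl]
        exact mul_le_mul hlL (abs_real_inner_le_norm _ _) (abs_nonneg _) hLam.le
      refine (abs_sub _ _).trans ?_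
      linarith)
  have t1 : ‖uh t - u t‖ ≤ ‖uh t - v t‖ + ‖u t - v t‖ := by
    rw [norm_sub_rev (u t)]; exact norm_sub_le_norm_sub_add_norm_sub _ _ _
  have t2 : ‖ph t - p t‖ ≤ ‖ph t - q t‖ + ‖p t - q t‖ := by
    rw [norm_sub_rev (p t)]; exact norm_sub_le_norm_sub_add_norm_sub _ _ _
  have t3 : (Na * ‖u t - v t‖ + Nb * ‖p t - q t‖ + K * Φ) +
      (Nb * ‖u t - v t‖ + Lam * ‖p t - q t‖) ≤
      (Na + Nb + Lam) * (‖u t - v t‖ + ‖p t - q t‖) + K * Φ := by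
    have e4 : 0 ≤ Lam * ‖u t - v t‖ := by positivity
    have e5 : 0 ≤ Na * ‖p t - q t‖ := by positivity
    linarith
  have t4 := mul_le_mul_of_nonneg_left t3 hC.le
  linarith
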